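/- Let X = ε f(u)u_x with f'(u) ≠ 0. If P ∈ D̃ is a homogeneous differential operator of degree at least 2 (i.e. P = Σ_{s=0}^m P_s ∂_x^s with P_s ∈ R̃ and deg P_s + s = deg P ≥ 2 for all s) satisfying Lie_X P = 0, then P = 0. -/

import Mathlib

open scoped BigOperators ContDiff

set_option maxHeartbeats 1000000
set_option synthInstance.maxHeartbeats 1000000

noncomputable section

attribute [local instance] Classical.propDecidable

/-! ### The coefficient ring `C^∞(u₀)` : smooth functions on an open set `s ⊆ ℝ` -/

def SF (s : Set ℝ) : Subalgebra ℝ (ℝ → ℝ) where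
  carrier := {f | ContDiffOn ℝ ∞ f s}
  mul_mem' hf hg := hf.mul hg
  add_mem' hf hg := hf.add hg
  algebraMap_mem' c := contDiffOn_const

/-- derivative (within `s`) of a smooth function, extended by `0` outside `s`. -/
def dSF (s : Set ℝ) (hs : IsOpen s) (f : SF s) : SF s :=
  ⟨fun x => if x ∈ s then derivWithin (f : ℝ → ℝ) s x else 0, by
    have h1 : ContDiffOn ℝ ∞ (derivWithin (f : ℝ → ℝ) s) s :=
      f.2.derivWithin hs.uniqueDiffOn (by exact_mod_cast le_refl _)
    exact h1.congr fun x hx => if_pos hx⟩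

/-! ### The ambient ring of (generalized) differential polynomials.

A monomial exponent `(z, b, l) : Mon` stands for
`u₁^z * ∏ₖ u_{k+2}^(b k) * (log u₁)^l`, and an element of `Rl s` is a finite
`C^∞(u₀)`-linear combination of such monomials.  Ordinary differential polynomials,
almost differential polynomials, etc. are carved out by predicates below. -/

abbrev Mon : Type := ℤ × (ℕ →₀ ℕ) × ℕ

abbrev Rl (s : Set ℝ) := AddMonoidAlgebra (SF s) Mon

variable (s : Set ℝ)

/-- embedding of a smooth function of `u₀` as a differential polynomial -/
def CF (c : SF s) : Rl s := AddMonoidAlgebra.single (0, 0, 0) c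

/-- the function `u₀ ↦ u₀` -/
def idSF : SF s := ⟨fun x => x, contDiffOn_id⟩

/-- the jet variable `u_ℓ = ∂ₓ^ℓ u` as an element of `Rl s` -/
def uVar : ℕ → Rl s
  | 0 => AddMonoidAlgebra.single (0, 0, 0) (idSF s)
  | 1 => AddMonoidAlgebra.single (1, 0, 0) 1
  | (k+2) => AddMonoidAlgebra.single (0, Finsupp.single k 1, 0) 1

/-- `log u₁` as an element of `Rl s` -/
def logUx : Rl s := AddMonoidAlgebra.single (0, 0, 1) 1

variable (hs : IsOpen s)

/-- the partial derivative `∂/∂u_i` on `Rl s` -/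
def pd (i : ℕ) (p : Rl s) : Rl s :=
  match i with
  | 0 => Finsupp.sum p.coeff fun m c => AddMonoidAlgebra.single m (dSF s hs c)
  | 1 => Finsupp.sum p.coeff fun m c =>
      AddMonoidAlgebra.single (m.1 - 1, m.2.1, m.2.2) (m.1 • c)
      + AddMonoidAlgebra.single (m.1 - 1, m.2.1, m.2.2 - 1) (m.2.2 • c)
  | (j+2) => Finsupp.sum p.coeff fun m c =>
      AddMonoidAlgebra.single (m.1, m.2.1 - Finsupp.single j 1, m.2.2) ((m.2.1 j) • c)

/-- the total `x`-derivative `∂ₓ = ∑ᵢ u_{i+1} ∂/∂uᵢ` -/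
def dx (p : Rl s) : Rl s := ∑ᶠ i, uVar s (i+1) * pd s hs i p

/-- the variational derivative `δ/δu = ∑ᵢ (-∂ₓ)^i ∘ ∂/∂uᵢ` -/
def varDer (p : Rl s) : Rl s := ∑ᶠ i, (-1 : Rl s)^i * (dx s hs)^[i] (pd s hs i p)

/-- `X̂(p) = ∑ᵢ ∂ₓ^i(x) · ∂p/∂uᵢ`, the evolutionary vector field generated by `x` -/
def XhatR (x p : Rl s) : Rl s := ∑ᶠ i, (dx s hs)^[i] x * pd s hs i p

/-! ### ε-series -/

/-- an `ε`-power series with coefficients in `Rl s`; `a n` is the coefficient of `ε^n`. -/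
abbrev Ser := ℕ → Rl s

def mulSer (a b : Ser s) : Ser s := fun n => ∑ k ∈ Finset.range (n+1), a k * b (n-k)

def XhatSer (X f : Ser s) : Ser s :=
  fun n => ∑ k ∈ Finset.range (n+1), XhatR s hs (X k) (f (n-k))

/-- the Lie bracket `[X,Y] = X̂(Y) - Ŷ(X)` on vector fields -/
def brk (X Y : Ser s) : Ser s := fun n => XhatSer s hs X Y n - XhatSer s hs Y X n

def varDerSer (f : Ser s) : Ser s := fun n => varDer s hs (f n)

def dxSer (f : Ser s) : Ser s := fun n => dx s hs (f n)

/-- multiplication by `ε` -/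
def shiftEps (a : Ser s) : Ser s := fun n => match n with | 0 => 0 | m+1 => a m

/-! ### gradings and the various subspaces -/

/-- total degree of a monomial, where `deg u_ℓ = ℓ`, `deg (log u₁) = 0`. -/
def wtM (m : Mon) : ℤ := m.1 + (m.2.1.sum fun k e => ((k:ℤ)+2) * e)

/-- homogeneous of degree `d` -/
def IsHomog (d : ℤ) (p : Rl s) : Prop := ∀ m ∈ p.coeff.support, wtM m = d

def NoLog (p : Rl s) : Prop := ∀ m ∈ p.coeff.support, m.2.2 = 0

/-- `p` is a genuine differential polynomial, i.e. `p ∈ R = C^∞(u₀)[u₁, u₂, …]` -/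
def InR (p : Rl s) : Prop := NoLog s p ∧ ∀ m ∈ p.coeff.support, 0 ≤ m.1

/-- `p` is an almost differential polynomial, i.e.
`p ∈ R̃ = C^∞(u₀)[u₁, u₂/u₁², u₃/u₁³, …]` -/
def InRt (p : Rl s) : Prop := NoLog s p ∧ ∀ m ∈ p.coeff.support, 0 ≤ wtM m

/-- `p` depends only on `u, uₓ, …, u⁽ᴺ⁾` -/
def UsesVarsLe (N : ℕ) (p : Rl s) : Prop :=
  ∀ m ∈ p.coeff.support, (m.1 ≠ 0 → 1 ≤ N) ∧ ∀ k, m.2.1 k ≠ 0 → k + 2 ≤ N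

/-- membership in `𝒜 = {∑_{i≥0} εⁱ fᵢ | fᵢ ∈ R, deg fᵢ = i}` -/
def InA (a : Ser s) : Prop := ∀ i, InR s (a i) ∧ IsHomog s i (a i)

/-- membership in `ℬ = {∑_{i≥1} εⁱ fᵢ | fᵢ ∈ R, deg fᵢ = i}` -/
def InB (a : Ser s) : Prop := InA s a ∧ a 0 = 0

def InAt (a : Ser s) : Prop := ∀ i, InRt s (a i) ∧ IsHomog s i (a i)

/-- membership in `ℬ̃` (almost differential polynomial vector fields) -/
def InBt (a : Ser s) : Prop := InAt s a ∧ a 0 = 0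

/-! ### local functionals -/

/-- the subspace `∂ₓ(·) ⊕ ℝ` by which densities are quotiented; `Pr` singles out the
class of densities used (`InA` for `Λ`, `InAt` for `Λ̃`). -/
def LamSub (Pr : Ser s → Prop) : Submodule ℝ (Ser s) :=
  Submodule.span ℝ
    ({a | ∃ b : Ser s, Pr b ∧ a = fun n => dx s hs (b n)} ∪
     {a | ∃ c : ℝ, a = fun n => if n = 0 then algebraMap ℝ (Rl s) c else 0})

instance serHasQuotient : HasQuotient (Ser s) (Submodule ℝ (Ser s)) :=
  Submodule.hasQuotient (R := ℝ) (M := Ser s)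

/-- the space of local functionals `Λ = 𝒜/(∂ₓ𝒜 ⊕ ℝ)` (resp. `Λ̃`). -/
abbrev Lam (Pr : Ser s → Prop) := (Ser s) ⧸ LamSub s hs Pr

instance lamAddCommGroup (Pr : Ser s → Prop) : AddCommGroup (Lam s hs Pr) :=
  Submodule.Quotient.addCommGroup _

instance lamModule (Pr : Ser s → Prop) : Module ℝ (Lam s hs Pr) :=
  Submodule.Quotient.module _

/-- the local functional `∫ f dx` with density `f` -/
def intdx (Pr : Ser s → Prop) (f : Ser s) : Lam s hs Pr := Submodule.Quotient.mk f

/-! ### differential operators -/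

/-- a differential operator `∑_{n,j} εⁿ P n j ∂ₓ^j`. -/
abbrev Op := ℕ → ℕ → Rl s

/-- membership in `𝒟 = {∑_{k≥0} ε^k ∑_{s=0}^{k+1} P_{k,s} ∂ₓ^{k+1-s} | P_{k,s} ∈ R, deg P_{k,s} = s}` -/
def InD (P : Op s) : Prop :=
  ∀ n j, (n+1 < j → P n j = 0) ∧
    (j ≤ n+1 → InR s (P n j) ∧ IsHomog s ((n:ℤ)+1-j) (P n j))

/-- same, with almost differential polynomial coefficients (`𝒟̃`). -/
def InDt (P : Op s) : Prop :=
  ∀ n j, (n+1 < j → P n j = 0) ∧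
    (j ≤ n+1 → InRt s (P n j) ∧ IsHomog s ((n:ℤ)+1-j) (P n j))

/-- application of an operator to an `ε`-series -/
def appOp (P : Op s) (a : Ser s) : Ser s :=
  fun n => ∑ k ∈ Finset.range (n+1), ∑ᶠ j, P k j * (dx s hs)^[j] (a (n-k))

/-- composition (product) of differential operators -/
def compOp (P Q : Op s) : Op s :=
  fun n j => ∑ k ∈ Finset.range (n+1), ∑ᶠ i, ∑ᶠ l, ∑ r ∈ Finset.range (i+1),
    if i - r + l = j then (i.choose r : Rl s) * P k i * (dx s hs)^[r] (Q (n-k) l) else 0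

/-- the density `(δF/δu) · P(δG/δu)` of the Poisson bracket `{F,G}_P` -/
def pbDen (P : Op s) (f g : Ser s) : Ser s :=
  mulSer s (varDerSer s hs f) (appOp s hs P (varDerSer s hs g))

/-- `P ∈ 𝒟` is a Hamiltonian operator:  `{F,G}_P = ∫ (δF/δu) P (δG/δu) dx` is a
Lie bracket on `Λ` (skew-symmetric and satisfying the Jacobi identity). -/
def IsHamOp (P : Op s) : Prop :=
  InD s P ∧
  (∀ f g : Ser s, InA s f → InA s g →
      intdx s hs (InA s) (pbDen s hs P f g) + intdx s hs (InA s) (pbDen s hs P g f) = 0) ∧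
  (∀ f g h : Ser s, InA s f → InA s g → InA s h →
      intdx s hs (InA s) (pbDen s hs P (pbDen s hs P f g) h)
    + intdx s hs (InA s) (pbDen s hs P (pbDen s hs P g h) f)
    + intdx s hs (InA s) (pbDen s hs P (pbDen s hs P h f) g) = 0)

/-- the operator `∑ₖ (∂X/∂uₖ)·∂ₓ^k` -/
def opL (X : Ser s) : Op s := fun n k => pd s hs k (X n)

/-- the operator `∑ₖ (-∂ₓ)^k ∘ (∂X/∂uₖ ·)`, written in normal form -/
def opR (X : Ser s) : Op s := fun n j =>
  ∑ᶠ k, if j ≤ k then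
    (-1 : Rl s)^k * (k.choose (k-j) : Rl s) * (dx s hs)^[k-j] (pd s hs k (X n)) else 0

/-- the Lie derivative `Lie_X P` of an operator along an evolutionary vector field,
given by formula (2.7) of the paper:
`Lie_X P = ∑_s X̂(P_s)∂ₓ^s - ∑ₖ ((∂X/∂uₖ)·∂ₓ^k·P + P·(-∂ₓ)^k·(∂X/∂uₖ))`. -/
def LieOp (X : Ser s) (P : Op s) : Op s := fun n j =>
  (∑ k ∈ Finset.range (n+1), XhatR s hs (X k) (P (n-k) j))
  - compOp s hs (opL s hs X) P n j - compOp s hs P (opR s hs X) n j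

/-! ### Miura / quasi-Miura transformations `g_Y = e^{ad_Y}` -/

/-- action of `g_Y = e^{ad_Y}` on vector fields (`ad_Y X = [Y,X]`);
the sum may be truncated at order `m = n` since `Y` has no `ε⁰`-term. -/
def gV (Y X : Ser s) : Ser s :=
  fun n => ∑ m ∈ Finset.range (n+1), ((m.factorial : ℝ)⁻¹) • ((brk s hs Y)^[m] X n)

/-- action of `g_Y = e^{ad_Y}` on operators (`ad_Y P = Lie_Y P`) -/
def gOp (Y : Ser s) (P : Op s) : Op s :=
  fun n j => ∑ m ∈ Finset.range (n+1), ((m.factorial : ℝ)⁻¹) • ((LieOp s hs Y)^[m] P n j)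

/-- action of `g_Y = e^{ad_Y}` on local functionals, at the level of densities
(`ad_Y F = Y.F = ∫ Ŷ(f) dx`) -/
def gF (Y f : Ser s) : Ser s :=
  fun n => ∑ m ∈ Finset.range (n+1), ((m.factorial : ℝ)⁻¹) • ((XhatSer s hs Y)^[m] f n)

/-! ### some particular elements -/

/-- the hydrodynamic Hamiltonian operator `g(u)∂ₓ + ½ g'(u)uₓ` -/
def hydroOp (g : SF s) : Op s := fun n j =>
  if n = 0 ∧ j = 1 then CF s g
  else if n = 0 ∧ j = 0 then (1/2 : ℝ) • (CF s (dSF s hs g) * uVar s 1) else 0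

/-- the differential polynomial `f(u)·uₓ` -/
def fux (f : SF s) : Rl s := CF s f * uVar s 1

/-- the vector field `ε f(u) uₓ` -/
def bfield (f : SF s) : Ser s := fun n => if n = 1 then fux s f else 0

/-- the series `u` itself (at order `ε⁰`) -/
def uSer : Ser s := fun n => if n = 0 then uVar s 0 else 0

def onesSer : Ser s := fun n => if n = 0 then 1 else 0

def serPow (a : Ser s) : ℕ → Ser s
  | 0 => onesSer s
  | (j+1) => mulSer s a (serPow a j)

def iterDSF : ℕ → SF s → SF s
  | 0, f => f
  | (j+1), f => dSF s hs (iterDSF j f)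

/-- substitution of an `ε`-series `v = u + O(ε)` into a smooth function `f`,
via the Taylor expansion `f(v) = ∑ⱼ f⁽ʲ⁾(u)(v-u)ʲ/j!`. -/
def fSubst (f : SF s) (v : Ser s) : Ser s := fun n =>
  ∑ j ∈ Finset.range (n+1), ((j.factorial : ℝ)⁻¹) •
    (mulSer s (fun m => if m = 0 then CF s (iterDSF s hs j f) else 0)
      (serPow s (fun m => v m - uSer s m) j)) n

/-- the multiplication operator by `q ∈ Rl s` -/
def multOp (q : Rl s) : Op s := fun n j => if n = 0 ∧ j = 0 then q else 0

/-- the operator `∂ₓ` -/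
def dxOp : Op s := fun n j => if n = 0 ∧ j = 1 then 1 else 0


/-! ## Setting for this statement -/

abbrev S : Set ℝ := Set.univ

lemma hS : IsOpen S := isOpen_univ


abbrev sg (m : Mon) (c : SF S) : Rl S := AddMonoidAlgebra.single m c

abbrev dd (c : SF S) : SF S := dSF S hS c

lemma dd_apply (c : SF S) (x : ℝ) : (dd c : ℝ → ℝ) x = deriv (c : ℝ → ℝ) x := by
  simp [dd, dSF]

lemma SF_diff (c : SF S) (x : ℝ) : DifferentiableAt ℝ (c : ℝ → ℝ) x := by
  have h : ContDiffOn ℝ ∞ (c : ℝ → ℝ) S := c.2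
  rw [contDiffOn_univ] at h
  exact h.differentiable (by simp) x

lemma dd_add (a b : SF S) : dd (a + b) = dd a + dd b := by
  apply Subtype.ext
  funext x
  have h : ((dd a + dd b : SF S) : ℝ → ℝ) x = (dd a : ℝ → ℝ) x + (dd b : ℝ → ℝ) x := rfl
  rw [h, dd_apply, dd_apply, dd_apply]
  exact deriv_add (SF_diff a x) (SF_diff b x)

lemma dd_zero : dd 0 = 0 := by
  have := dd_add 0 0
  simpa using this

lemma pd_single_zero (m : Mon) (c : SF S) : pd S hS 0 (sg m c) = sg m (dd c) := by
  unfold pd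
  rw [AddMonoidAlgebra.coeff_single, Finsupp.sum_single_index]
  rw [← dd, dd_zero]; simp

lemma pd_one_def (p : Rl S) : pd S hS 1 p = Finsupp.sum p.coeff fun m c =>
      AddMonoidAlgebra.single (m.1 - 1, m.2.1, m.2.2) (m.1 • c)
      + AddMonoidAlgebra.single (m.1 - 1, m.2.1, m.2.2 - 1) (m.2.2 • c) := rfl

lemma pd_two_def (j : ℕ) (p : Rl S) : pd S hS (j+2) p = Finsupp.sum p.coeff fun m c =>
      AddMonoidAlgebra.single (m.1, m.2.1 - Finsupp.single j 1, m.2.2) ((m.2.1 j) • c) := rfl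

lemma pd_zero_def (p : Rl S) : pd S hS 0 p =
    Finsupp.sum p.coeff fun m c => AddMonoidAlgebra.single m (dSF S hS c) := rfl

lemma pd_single_one (m : Mon) (c : SF S) : pd S hS 1 (sg m c) =
    sg (m.1 - 1, m.2.1, m.2.2) (m.1 • c) + sg (m.1 - 1, m.2.1, m.2.2 - 1) (m.2.2 • c) := by
  rw [pd_one_def, AddMonoidAlgebra.coeff_single, Finsupp.sum_single_index]
  simp

lemma pd_single_add_two (j : ℕ) (m : Mon) (c : SF S) : pd S hS (j+2) (sg m c) =
    sg (m.1, m.2.1 - Finsupp.single j 1, m.2.2) ((m.2.1 j) • c) := by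
  rw [pd_two_def, AddMonoidAlgebra.coeff_single, Finsupp.sum_single_index]
  simp

lemma pd_add (i : ℕ) (p q : Rl S) : pd S hS i (p + q) = pd S hS i p + pd S hS i q := by
  match i with
  | 0 =>
    simp only [pd_zero_def]
    rw [AddMonoidAlgebra.coeff_add, Finsupp.sum_add_index']
    · intro m
      rw [← dd, dd_zero]; simp
    · intro m a b
      rw [← dd, dd_add, AddMonoidAlgebra.single_add]
  | 1 =>
    simp only [pd_one_def]
    rw [AddMonoidAlgebra.coeff_add, Finsupp.sum_add_index']
    · intro m
      simp
    · intro m a b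
      simp only [smul_add, AddMonoidAlgebra.single_add]
      abel
  | j+2 =>
    simp only [pd_two_def]
    rw [AddMonoidAlgebra.coeff_add, Finsupp.sum_add_index']
    · intro m
      simp
    · intro m a b
      simp only [smul_add, AddMonoidAlgebra.single_add]

def pdH (i : ℕ) : Rl S →+ Rl S := AddMonoidHom.mk' (pd S hS i) (pd_add i)

lemma pdH_apply (i : ℕ) (p : Rl S) : pdH i p = pd S hS i p := rfl

lemma pd_zero (i : ℕ) : pd S hS i 0 = 0 := (pdH i).map_zero

lemma eq_sum_sg (p : Rl S) : p = ∑ m ∈ p.coeff.support, sg m (p.coeff m) :=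
  (AddMonoidAlgebra.sum_coeff_single p).symm

lemma pd_large (p : Rl S) : ∃ N : ℕ, ∀ j, N ≤ j → pd S hS (j+2) p = 0 := by
  induction p using AddMonoidAlgebra.induction_linear with
  | zero => exact ⟨0, fun j _ => pd_zero _⟩
  | add p q hp hq =>
    obtain ⟨N, hN⟩ := hp
    obtain ⟨M, hM⟩ := hq
    refine ⟨max N M, fun j hj => ?_⟩
    rw [pd_add, hN j (le_trans (le_max_left _ _) hj), hM j (le_trans (le_max_right _ _) hj), add_zero]
  | single m c =>
    refine ⟨m.2.1.support.sup id + 1, fun j hj => ?_⟩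
    rw [pd_single_add_two]
    have : m.2.1 j = 0 := by
      by_contra h
      have := Finset.le_sup (f := id) (Finsupp.mem_support_iff.mpr h)
      simp only [id] at this
      omega
    simp [this]

lemma finsum_eq_range (A : ℕ → Rl S) (p : Rl S) (N : ℕ) (hN : ∀ j, N ≤ j → pd S hS (j+2) p = 0) :
    ∑ᶠ i, A i * pd S hS i p = ∑ i ∈ Finset.range (N+2), A i * pd S hS i p := by
  apply finsum_eq_sum_of_support_subset
  intro i hi
  simp only [Function.mem_support] at hi
  simp only [Finset.coe_range, Set.mem_Iio]
  by_contra h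
  apply hi
  have := hN (i-2) (by omega)
  rw [show i - 2 + 2 = i by omega] at this
  rw [this, mul_zero]

lemma dx_add (p q : Rl S) : dx S hS (p + q) = dx S hS p + dx S hS q := by
  obtain ⟨N, hN⟩ := pd_large p
  obtain ⟨M, hM⟩ := pd_large q
  have h1 : ∀ j, max N M ≤ j → pd S hS (j+2) p = 0 := fun j hj => hN j (le_trans (le_max_left _ _) hj)
  have h2 : ∀ j, max N M ≤ j → pd S hS (j+2) q = 0 := fun j hj => hM j (le_trans (le_max_right _ _) hj)
  have h3 : ∀ j, max N M ≤ j → pd S hS (j+2) (p+q) = 0 := fun j hj => by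
    rw [pd_add, h1 j hj, h2 j hj, add_zero]
  unfold dx
  rw [finsum_eq_range (fun i => uVar S (i+1)) p _ h1, finsum_eq_range (fun i => uVar S (i+1)) q _ h2,
    finsum_eq_range (fun i => uVar S (i+1)) (p+q) _ h3]
  rw [← Finset.sum_add_distrib]
  simp only [pd_add, mul_add]

def dxH : Rl S →+ Rl S := AddMonoidHom.mk' (dx S hS) dx_add

lemma dx_zero : dx S hS 0 = 0 := dxH.map_zero
lemma dx_neg (p : Rl S) : dx S hS (-p) = - dx S hS p := by
  apply eq_neg_of_add_eq_zero_left
  have h := dx_add (-p) p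
  rw [show -p + p = 0 by ring, dx_zero] at h
  exact h.symm

lemma dx_iter_zero (r : ℕ) : (dx S hS)^[r] 0 = 0 := by
  induction r with
  | zero => rfl
  | succ r ih => rw [Function.iterate_succ_apply', ih, dx_zero]

lemma mon_add (z z' : ℤ) (b b' : ℕ →₀ ℕ) (l l' : ℕ) :
    ((z, b, l) : Mon) + (z', b', l') = (z + z', b + b', l + l') := rfl

lemma sg_mul (m m' : Mon) (c c' : SF S) : sg m c * sg m' c' = sg (m + m') (c * c') :=
  AddMonoidAlgebra.single_mul_single ..

lemma sg_add (m : Mon) (c c' : SF S) : sg m (c + c') = sg m c + sg m c' :=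
  AddMonoidAlgebra.single_add ..

lemma dx_single0 (z : ℤ) (c : SF S) : dx S hS (sg (z, 0, 0) c) =
    sg (z+1, 0, 0) (dd c) + sg (z-1, Finsupp.single 0 1, 0) (z • c) := by
  unfold dx
  rw [finsum_eq_range (fun i => uVar S (i+1)) _ 0 (by intro j _; rw [pd_single_add_two]; simp)]
  simp only [Finset.sum_range_succ, Finset.sum_range_zero, zero_add]
  rw [pd_single_zero, pd_single_one]
  simp only [uVar, zero_smul, AddMonoidAlgebra.single_zero, add_zero, sg_mul, mon_add, zero_add, one_mul]
  rw [add_comm 1 z]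

lemma dx_single1 (z : ℤ) (j : ℕ) (c : SF S) : dx S hS (sg (z, Finsupp.single j 1, 0) c) =
    sg (z+1, Finsupp.single j 1, 0) (dd c)
    + sg (z-1, Finsupp.single 0 1 + Finsupp.single j 1, 0) (z • c)
    + sg (z, Finsupp.single (j+1) 1, 0) c := by
  unfold dx
  rw [finsum_eq_sum_of_support_subset (s := {0, 1, j+2})]
  · rw [Finset.sum_insert (by simp), Finset.sum_insert (by simp), Finset.sum_singleton]
    rw [pd_single_zero, pd_single_one, pd_single_add_two]
    simp only [uVar, zero_smul, AddMonoidAlgebra.single_zero, add_zero, sg_mul, mon_add, zero_add, one_mul, tsub_self, Finsupp.single_eq_same, one_smul]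
    rw [add_comm 1 z, add_assoc]
  · intro i hi
    simp only [Function.mem_support] at hi
    simp only [Finset.coe_insert, Finset.coe_singleton, Set.mem_insert_iff, Set.mem_singleton_iff]
    by_contra! h
    obtain ⟨k, rfl⟩ : ∃ k, i = k + 2 := ⟨i - 2, by omega⟩
    apply hi
    rw [pd_single_add_two]
    simp [show j ≠ k by omega]

/-- weight -/
def Phi (m : Mon) : ℤ := m.2.1.sum fun k e => ((k:ℤ)+1)^2 * e

lemma Phi_mk_add (z z' : ℤ) (b b' : ℕ →₀ ℕ) (l l' : ℕ) :
    Phi (z, b + b', l) = Phi (z', b, l') + Phi (0, b', 0) := by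
  unfold Phi
  rw [Finsupp.sum_add_index']
  · simp
  · intro k x y; push_cast; ring

lemma Phi_add (m m' : Mon) : Phi (m + m') = Phi m + Phi m' := by
  unfold Phi
  rw [show (m + m').2.1 = m.2.1 + m'.2.1 from rfl, Finsupp.sum_add_index']
  · simp
  · intro k x y; push_cast; ring

lemma Phi_zero (z : ℤ) (l : ℕ) : Phi (z, 0, l) = 0 := by simp [Phi]

lemma Phi_single (z : ℤ) (j l : ℕ) : Phi (z, Finsupp.single j 1, l) = ((j:ℤ)+1)^2 := by
  simp [Phi]

lemma Phi_nonneg (m : Mon) : 0 ≤ Phi m := by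
  unfold Phi
  exact Finsupp.sum_nonneg (fun k _ => by positivity)

lemma Phi_sub (z z' : ℤ) (b : ℕ →₀ ℕ) (j l l' : ℕ) (h : b j ≠ 0) :
    Phi (z, b - Finsupp.single j 1, l) = Phi (z', b, l') - ((j:ℤ)+1)^2 := by
  have hb : b - Finsupp.single j 1 + Finsupp.single j 1 = b := by
    apply tsub_add_cancel_of_le
    simpa [Finsupp.single_le_iff] using Nat.one_le_iff_ne_zero.mpr h
  have := Phi_mk_add z' z (b - Finsupp.single j 1) (Finsupp.single j 1) l' l
  rw [hb, Phi_single] at this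
  linarith

def Fl (w : ℤ) : AddSubmonoid (Rl S) where
  carrier := {p | ∀ m, p.coeff m ≠ 0 → Phi m ≤ w}
  zero_mem' := by intro m hm; simp at hm
  add_mem' := by
    intro p q hp hq m hm
    by_cases h : p.coeff m = 0
    · exact hq m (by intro h'; apply hm; simp [h, h'])
    · exact hp m h

lemma sg_mem (w : ℤ) (m : Mon) (c : SF S) (h : Phi m ≤ w) : sg m c ∈ Fl w := by
  intro m' hm'
  by_cases e : m = m'
  · exact e ▸ h
  · exact absurd (by simp [e]) hm'

lemma Fl_map (T : Rl S →+ Rl S) (w w' : ℤ) (hT : ∀ m c, Phi m ≤ w → T (sg m c) ∈ Fl w') (p : Rl S)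
    (hp : p ∈ Fl w) : T p ∈ Fl w' := by
  rw [eq_sum_sg p, map_sum]
  apply AddSubmonoid.sum_mem
  intro m hm
  exact hT _ _ (hp m (Finsupp.mem_support_iff.mp hm))

lemma Fl_mul_sg (w : ℤ) (p : Rl S) (hp : p ∈ Fl w) (m : Mon) (c : SF S) : p * sg m c ∈ Fl (w + Phi m) := by
  refine Fl_map (AddMonoidHom.mulRight (sg m c)) w _ ?_ p hp
  intro m' c' h
  change sg m' c' * sg m c ∈ _
  rw [sg_mul]
  apply sg_mem
  rw [Phi_add]; linarith

lemma dx_Fl (k : ℕ) (p : Rl S) (hp : p ∈ Fl (((k:ℤ)+1)^2 - 1)) : dx S hS p ∈ Fl (((k:ℤ)+2)^2 - 1) := by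
  refine Fl_map dxH _ _ ?_ p hp
  rintro ⟨z, b, l⟩ c h
  change dx S hS _ ∈ _
  obtain ⟨N, hN⟩ := pd_large (sg (z, b, l) c)
  unfold dx
  rw [finsum_eq_range (fun i => uVar S (i+1)) _ N hN]
  apply AddSubmonoid.sum_mem
  intro i _
  match i with
  | 0 =>
    rw [pd_single_zero, uVar, sg_mul]
    apply sg_mem
    rw [Phi_add, Phi_zero]; have := Int.natCast_nonneg k; nlinarith
  | 1 =>
    rw [pd_single_one, uVar, mul_add, sg_mul, sg_mul]
    apply AddSubmonoid.add_mem
    · apply sg_mem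
      rw [Phi_add, Phi_single]
      change _ + Phi (z, b, l) ≤ _
      have := Int.natCast_nonneg k
      push_cast; nlinarith
    · apply sg_mem
      rw [Phi_add, Phi_single]
      change _ + Phi (z, b, l) ≤ _
      have := Int.natCast_nonneg k
      push_cast; nlinarith
  | j+2 =>
    rw [pd_single_add_two, uVar, sg_mul]
    by_cases hb : b j = 0
    · simp [hb]
    apply sg_mem
    rw [Phi_add, Phi_single]
    simp only
    rw [Phi_sub z z b j l l hb]
    have h0 := Phi_nonneg (z, b - Finsupp.single j 1, l)
    rw [Phi_sub z z b j l l hb] at h0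
    have : (j:ℤ) + 1 < (k:ℤ)+1 := by
      apply lt_of_pow_lt_pow_left₀ 2 (by positivity)
      linarith
    push_cast
    nlinarith

lemma fux_eq (f : SF S) : fux S f = sg (1, 0, 0) f := by
  unfold fux CF
  rw [uVar, sg_mul]; simp

lemma dx_iter_fux (f : SF S) (k : ℕ) : ∃ B ∈ Fl (((k:ℤ)+1)^2 - 1),
    (dx S hS)^[k+2] (fux S f) = sg (0, Finsupp.single (k+1) 1, 0) f
      + sg (1, Finsupp.single k 1, 0) (((k:ℤ)+3) • dd f) + B := by
  induction k with
  | zero =>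
    refine ⟨sg (3,0,0) (dd (dd f)), sg_mem _ _ _ (by rw [Phi_zero]; norm_num), ?_⟩
    rw [Function.iterate_succ_apply', Function.iterate_succ_apply', Function.iterate_zero, id, fux_eq]
    rw [dx_single0, one_smul, dx_add, dx_single0, sub_self, dx_single1, zero_smul]
    simp only [AddMonoidAlgebra.single_zero]
    simp only [Nat.cast_zero, zero_add, show (1:ℤ)+1 = 2 by norm_num, show (2:ℤ)+1 = 3 by norm_num, show (2:ℤ)-1 = 1 by norm_num, add_zero]
    rw [show ((3:ℤ) • dd f : SF S) = (2:ℤ) • dd f + dd f by module, sg_add]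
    abel
  | succ k ih =>
    obtain ⟨B, hB, h⟩ := ih
    refine ⟨dx S hS B + sg (2, Finsupp.single k 1, 0) (dd (((k:ℤ)+3) • dd f))
      + sg (0, Finsupp.single 0 1 + Finsupp.single k 1, 0) (((k:ℤ)+3) • dd f), ?_, ?_⟩
    · refine AddSubmonoid.add_mem _ (AddSubmonoid.add_mem _ ?_ ?_) ?_
      · have := dx_Fl k B hB
        convert this using 2
        push_cast; ring
      · apply sg_mem
        rw [Phi_single]; push_cast; have := Int.natCast_nonneg k; nlinarith
      · apply sg_mem
        rw [Phi_mk_add 0 0 _ _ 0 0, Phi_single, Phi_single]; push_cast; have := Int.natCast_nonneg k; nlinarith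
    · rw [show k + 1 + 2 = (k + 2) + 1 by ring, Function.iterate_succ_apply', h, dx_add, dx_add, dx_single1, dx_single1,
        zero_smul, one_smul]
      simp only [AddMonoidAlgebra.single_zero]
      simp only [Nat.cast_add, Nat.cast_one, zero_add, show (1:ℤ)+1 = 2 by norm_num, sub_self, add_zero]
      rw [show (((k:ℤ)+1+3) • dd f : SF S) = ((k:ℤ)+3) • dd f + dd f by module, sg_add]
      abel

def ee (i : ℕ) (m : Mon) : ℤ := match i with
  | 0 => 0
  | 1 => m.1
  | k+2 => ((k:ℤ)+3) * m.2.1 k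

lemma coeff_sg (m m' : Mon) (c : SF S) : (sg m c).coeff m' = if m = m' then c else 0 :=
  Finsupp.single_apply

lemma coeff_T (f : SF S) (i : ℕ) (m M : Mon) (c : SF S) (hm : m.2.2 = 0) (h : Phi m ≤ Phi M) :
    (((dx S hS)^[i] (fux S f) - CF S f * uVar S (i+1)) * pd S hS i (sg m c)).coeff (M + (1, 0, 0))
      = if m = M then ee i M • (dd f * c) else 0 := by
  obtain ⟨z, b, l⟩ := m
  simp only at hm
  subst hm
  match i with
  | 0 =>
    rw [Function.iterate_zero, id, fux, sub_self, zero_mul]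
    simp [ee]
  | 1 =>
    rw [Function.iterate_one, fux_eq, dx_single0, one_smul, CF, uVar, pd_single_one]
    simp only [zero_smul, AddMonoidAlgebra.single_zero, add_zero]
    rw [show sg (0,0,0) f * sg (0, Finsupp.single 0 1, 0) 1 = sg (1 - 1, Finsupp.single 0 1, 0) f by
      rw [sg_mul]; simp,
      show ∀ a b : Rl S, a + b - b = a from fun a b => by ring, sg_mul, coeff_sg]
    rw [show ((1 + 1, 0, 0) + (z - 1, b, 0) : Mon) = (z, b, 0) + (1, 0, 0) by
      simp only [mon_add]; refine Prod.ext ?_ ?_ <;> simp; ring]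
    simp only [add_left_inj]
    split_ifs with e
    · subst e; simp [ee]; ring
    · rfl
  | k+2 =>
    obtain ⟨B, hB, hx⟩ := dx_iter_fux f k
    rw [hx, CF, uVar, pd_single_add_two]
    rw [show sg (0,0,0) f * sg (0, Finsupp.single (k+1) 1, 0) 1 = sg (0, Finsupp.single (k+1) 1, 0) f by
      rw [sg_mul]; simp]
    rw [add_assoc, show ∀ a b : Rl S, a + b - a = b from fun a b => by ring, add_mul, sg_mul, AddMonoidAlgebra.coeff_add, Finsupp.add_apply]
    simp only
    by_cases hb : b k = 0
    · simp only [hb, zero_smul, mul_zero, AddMonoidAlgebra.single_zero, AddMonoidAlgebra.coeff_zero, Finsupp.zero_apply, add_zero]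
      split_ifs with e
      · subst e; simp [ee, hb]
      · rfl
    have h2 := Fl_mul_sg _ B hB (z, b - Finsupp.single k 1, 0) (b k • c)
    rw [Phi_sub z z b k 0 0 hb] at h2
    have h3 : (B * sg (z, b - Finsupp.single k 1, 0) (b k • c)).coeff (M + (1,0,0)) = 0 := by
      by_contra hne
      have := h2 _ hne
      rw [Phi_add, Phi_zero] at this
      linarith
    rw [h3, add_zero, coeff_sg]
    have hbb : Finsupp.single k 1 + (b - Finsupp.single k 1) = b := by
      apply add_tsub_cancel_of_le
      simpa [Finsupp.single_le_iff] using Nat.one_le_iff_ne_zero.mpr hb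
    rw [mon_add, hbb]
    rw [show ((1 + z, b, 0 + 0) : Mon) = (z, b, 0) + (1, 0, 0) by
      simp only [mon_add]; refine Prod.ext ?_ ?_ <;> simp; ring]
    simp only [add_left_inj]
    split_ifs with e
    · subst e
      simp only [ee, smul_mul_assoc, mul_smul_comm, mul_smul]
      rw [natCast_zsmul, smul_comm]
    · rfl

lemma comp_L (a P : ℕ → Rl S) (n : ℕ) (ha : ∀ i, 2 ≤ i → a i = 0) :
    (∑ᶠ i, ∑ᶠ l, ∑ r ∈ Finset.range (i+1),
      if i - r + l = n then (i.choose r : Rl S) * a i * (dx S hS)^[r] (P l) else 0)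
    = a 0 * P n + a 1 * dx S hS (P n) + (if n = 0 then 0 else a 1 * P (n-1)) := by
  rw [finsum_eq_sum_of_support_subset (s := {0, 1})]
  · rw [Finset.sum_insert (by simp), Finset.sum_singleton]
    have h0 : (∑ᶠ l, ∑ r ∈ Finset.range (0+1),
      if 0 - r + l = n then ((0:ℕ).choose r : Rl S) * a 0 * (dx S hS)^[r] (P l) else 0) = a 0 * P n := by
      rw [finsum_eq_single _ n]
      · simp
      · intro l hl
        simp [hl]
    have h1 : (∑ᶠ l, ∑ r ∈ Finset.range (1+1),
      if 1 - r + l = n then ((1:ℕ).choose r : Rl S) * a 1 * (dx S hS)^[r] (P l) else 0) =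
        a 1 * dx S hS (P n) + (if n = 0 then 0 else a 1 * P (n-1)) := by
      rcases n with _ | n
      · rw [finsum_eq_single _ 0]
        · simp [Finset.sum_range_succ]
        · intro l hl
          simp [Finset.sum_range_succ, hl]
      · rw [finsum_eq_sum_of_support_subset (s := {n, n+1})]
        · rw [Finset.sum_insert (by simp), Finset.sum_singleton]
          simp [Finset.sum_range_succ, add_comm 1]
          abel
        · intro l hl
          simp only [Function.mem_support] at hl
          simp only [Finset.coe_insert, Finset.coe_singleton, Set.mem_insert_iff, Set.mem_singleton_iff]
          by_contra! h
          apply hl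
          simp [Finset.sum_range_succ, h, add_comm 1]
    rw [h0, h1, add_assoc]
  · intro i hi
    simp only [Function.mem_support] at hi
    simp only [Finset.coe_insert, Finset.coe_singleton, Set.mem_insert_iff, Set.mem_singleton_iff]
    by_contra! h
    apply hi
    simp [ha i (by omega)]

lemma comp_R (b P : ℕ → Rl S) (n : ℕ) (hb : ∀ l, l ≠ 1 → b l = 0) (hP : ∀ i, n < i → P i = 0) :
    (∑ᶠ i, ∑ᶠ l, ∑ r ∈ Finset.range (i+1),
      if i - r + l = n then (i.choose r : Rl S) * P i * (dx S hS)^[r] (b l) else 0)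
    = (n : Rl S) * P n * dx S hS (b 1) + (if n = 0 then 0 else P (n-1) * b 1) := by
  have h1 : ∀ i, (∑ᶠ l, ∑ r ∈ Finset.range (i+1),
      if i - r + l = n then (i.choose r : Rl S) * P i * (dx S hS)^[r] (b l) else 0) =
      ∑ r ∈ Finset.range (i+1),
      if i - r + 1 = n then (i.choose r : Rl S) * P i * (dx S hS)^[r] (b 1) else 0 := by
    intro i
    rw [finsum_eq_single _ 1]
    intro l hl
    rw [hb l hl]
    simp [dx_iter_zero]
  simp only [h1]
  rcases n with _ | n
  · simp
  rw [finsum_eq_sum_of_support_subset (s := {n, n+1})]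
  · rw [Finset.sum_insert (by simp), Finset.sum_singleton]
    rw [Finset.sum_eq_single 0, Finset.sum_eq_single 1]
    · simp
      abel
    · intro r hr h
      rw [Finset.mem_range] at hr
      rw [if_neg (by omega)]
    · intro h; simp at h
    · intro r hr h
      rw [Finset.mem_range] at hr
      rw [if_neg (by omega)]
    · intro h; simp at h
  · intro i hi
    simp only [Function.mem_support] at hi
    simp only [Finset.coe_insert, Finset.coe_singleton, Set.mem_insert_iff, Set.mem_singleton_iff]
    by_contra! h
    apply hi
    by_cases hlt : n + 1 < i
    · simp [hP i hlt]
    · apply Finset.sum_eq_zero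
      intro r hr
      rw [if_neg (by omega)]

lemma pd_fux_zero (f : SF S) : pd S hS 0 (fux S f) = sg (1,0,0) (dd f) := by
  rw [fux_eq, pd_single_zero]

lemma pd_fux_one (f : SF S) : pd S hS 1 (fux S f) = CF S f := by
  rw [fux_eq, pd_single_one]; simp [CF]

lemma pd_fux_large (f : SF S) (i : ℕ) (hi : 2 ≤ i) : pd S hS i (fux S f) = 0 := by
  obtain ⟨k, rfl⟩ : ∃ k, i = k + 2 := ⟨i - 2, by omega⟩
  rw [fux_eq, pd_single_add_two]; simp

lemma dx_CF (f : SF S) : dx S hS (CF S f) = sg (1,0,0) (dd f) := by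
  have := dx_single0 0 f
  rw [CF]
  rw [this]; simp

lemma opR_one (f : SF S) (l : ℕ) : opR S hS (bfield S f) 1 l = if l = 1 then - CF S f else 0 := by
  unfold opR
  have hb : bfield S f 1 = fux S f := by simp [bfield]
  rw [hb, finsum_eq_sum_of_support_subset (s := {0, 1})]
  · rw [Finset.sum_insert (by simp), Finset.sum_singleton, pd_fux_zero, pd_fux_one]
    match l with
    | 0 =>
      simp only [le_refl, if_true, Nat.zero_le, Function.iterate_zero, id, Nat.sub_self, Nat.sub_zero, Nat.choose_self, Function.iterate_one, dx_CF]
      norm_num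
      ring
    | 1 =>
      simp
      ring
    | k+2 =>
      simp
  · intro i hi
    simp only [Function.mem_support] at hi
    simp only [Finset.coe_insert, Finset.coe_singleton, Set.mem_insert_iff, Set.mem_singleton_iff]
    by_contra! h
    apply hi
    rw [pd_fux_large f i (by omega)]
    simp [dx_iter_zero]

lemma XhatR_zero (x : Rl S) : XhatR S hS x 0 = 0 := by
  simp [XhatR, pd_zero]

lemma key_eq (f : SF S) (P : ℕ → Rl S) (n : ℕ) (hP : ∀ i, n < i → P i = 0)
    (hLie : LieOp S hS (bfield S f) (fun n j => if n = 0 then P j else 0) = fun _ _ => 0) :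
    XhatR S hS (fux S f) (P n) - CF S f * dx S hS (P n)
      = (1 - (n : Rl S)) * sg (1,0,0) (dd f) * P n := by
  have h := congrFun (congrFun hLie 1) n
  have hb : bfield S f 1 = fux S f := by simp [bfield]
  have hb0 : bfield S f 0 = 0 := by simp [bfield]
  simp only [LieOp, compOp] at h
  rw [Finset.sum_range_succ, Finset.sum_range_one, Finset.sum_range_succ, Finset.sum_range_one,
    Finset.sum_range_succ, Finset.sum_range_one] at h
  simp only [Nat.sub_self, Nat.sub_zero, one_ne_zero, if_false, if_true, hb, XhatR_zero, dx_iter_zero,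
    mul_zero, zero_mul, ite_self, Finset.sum_const_zero, finsum_zero, zero_add, add_zero] at h
  rw [comp_L _ P n (fun i hi => by rw [opL, hb, pd_fux_large f i hi]),
    comp_R _ P n (fun l hl => by rw [opR_one, if_neg hl]) hP] at h
  rw [opR_one, if_pos rfl, opL, opL, hb, pd_fux_zero, pd_fux_one, dx_neg, dx_CF] at h
  by_cases hn : n = 0
  · simp only [hn, if_true] at h ⊢
    linear_combination h
  · simp only [hn, if_false] at h
    linear_combination h

lemma pd_sum_sg (i : ℕ) (p : Rl S) : pd S hS i p = ∑ m ∈ p.coeff.support, pd S hS i (sg m (p.coeff m)) := by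
  conv_lhs => rw [eq_sum_sg p]
  exact map_sum (pdH i) _ _

lemma wt_le (M : Mon) (N : ℕ) (hN : ∀ k, N ≤ k → M.2.1 k = 0) :
    wtM M ≤ ∑ i ∈ Finset.range (N+2), ee i M := by
  unfold wtM
  rw [Finset.sum_range_succ', Finset.sum_range_succ', Finsupp.sum_of_support_subset (s := Finset.range N)]
  · simp only [ee, add_zero]
    rw [add_comm]
    gcongr with k hk
    norm_num
  · intro k hk
    rw [Finset.mem_range]
    by_contra h
    exact (Finsupp.mem_support_iff.mp hk) (hN k (by omega))
  · simp

lemma top_zero (f : SF S) (hf : ∀ x, (dSF S hS f : ℝ → ℝ) x ≠ 0) (d n : ℕ) (hd : 2 ≤ d) (p : Rl S)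
    (h1 : NoLog S p) (h2 : IsHomog S ((d:ℤ) - n) p)
    (h : XhatR S hS (fux S f) p - CF S f * dx S hS p = (1 - (n : Rl S)) * sg (1,0,0) (dd f) * p) :
    p = 0 := by
  by_contra hp
  have hne : p.coeff.support.Nonempty := by
    rw [Finsupp.support_nonempty_iff]
    intro h; exact hp (AddMonoidAlgebra.coeff_eq_zero.mp h)
  obtain ⟨M, hM, hmax⟩ := Finset.exists_max_image p.coeff.support Phi hne
  obtain ⟨N0, hN0⟩ := pd_large p
  obtain ⟨N, hN, hNM⟩ : ∃ N, N0 ≤ N ∧ ∀ k, N ≤ k → M.2.1 k = 0 := by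
    refine ⟨max N0 (M.2.1.support.sup id + 1), le_max_left _ _, fun k hk => ?_⟩
    by_contra h
    have := Finset.le_sup (f := id) (Finsupp.mem_support_iff.mpr h)
    have h' := le_trans (le_max_right _ _) hk
    simp only [id] at this
    omega
  have hN' : ∀ j, N ≤ j → pd S hS (j+2) p = 0 := fun j hj => hN0 j (hN.trans hj)
  have hT : XhatR S hS (fux S f) p - CF S f * dx S hS p =
      ∑ i ∈ Finset.range (N+2), ∑ m ∈ p.coeff.support,
        ((dx S hS)^[i] (fux S f) - CF S f * uVar S (i+1)) * pd S hS i (sg m (p.coeff m)) := by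
    unfold XhatR
    rw [finsum_eq_range (fun i => (dx S hS)^[i] (fux S f)) p N hN']
    conv_lhs => rw [dx]
    rw [finsum_eq_range (fun i => uVar S (i+1)) p N hN']
    simp only [← Finset.mul_sum, ← pd_sum_sg]
    rw [Finset.mul_sum]
    rw [sub_eq_iff_eq_add, ← Finset.sum_add_distrib]
    refine Finset.sum_congr rfl fun i _ => ?_
    ring
  have hc := congrArg (fun q => q.coeff (M + (1,0,0))) (hT.symm.trans h)
  simp only [AddMonoidAlgebra.coeff_sum, Finsupp.finsetSum_apply] at hc
  have hL : ∀ i ∈ Finset.range (N+2), (∑ m ∈ p.coeff.support,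
        (((dx S hS)^[i] (fux S f) - CF S f * uVar S (i+1)) * pd S hS i (sg m (p.coeff m))).coeff (M + (1,0,0)))
        = ee i M • (dd f * p.coeff M) := by
    intro i _
    rw [Finset.sum_congr rfl (fun m hm => coeff_T f i m M (p.coeff m) (h1 m hm) (hmax m hm))]
    rw [Finset.sum_ite_eq' , if_pos hM]
  rw [Finset.sum_congr rfl hL, ← Finset.sum_smul] at hc
  have hR : (1 - (n : Rl S)) * sg (1,0,0) (dd f) * p = ∑ m ∈ p.coeff.support,
      sg (m + (1,0,0)) ((1 - (n:ℤ)) • (dd f * p.coeff m)) := by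
    conv_lhs => rw [eq_sum_sg p, Finset.mul_sum]
    refine Finset.sum_congr rfl fun m _ => ?_
    have : (1 - (n : Rl S)) * sg (1,0,0) (dd f) * sg m (p.coeff m) = 
      (1 - (n : Rl S)) * (sg (1,0,0) (dd f) * sg m (p.coeff m)) := by ring
    rw [this, sg_mul, add_comm (1,0,0) m]
    have h3 : sg (m + (1,0,0)) ((1 - (n:ℤ)) • (dd f * p.coeff m))
      = (1 - (n:ℤ)) • sg (m + (1,0,0)) (dd f * p.coeff m) := 
      map_zsmul (AddMonoidHom.mk' (fun c : SF S => sg (m + (1,0,0)) c) (sg_add _)) _ _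
    rw [h3, zsmul_eq_mul]
    push_cast
    rfl
  rw [hR] at hc
  simp only [AddMonoidAlgebra.coeff_sum, Finsupp.finsetSum_apply, coeff_sg, add_left_inj] at hc
  rw [Finset.sum_ite_eq', if_pos hM] at hc
  have hw := wt_le M N hNM
  rw [h2 M hM] at hw
  have hz : (∑ i ∈ Finset.range (N+2), ee i M - (1 - (n:ℤ))) • (dd f * p.coeff M) = 0 := by
    rw [sub_smul, hc, sub_self]
  apply Finsupp.mem_support_iff.mp hM
  apply Subtype.ext
  funext x
  have hx := congrFun (congrArg Subtype.val hz) x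
  have hx' : ((∑ i ∈ Finset.range (N+2), ee i M - (1 - (n:ℤ)) : ℤ) : ℝ) *
    ((dSF S hS f : ℝ → ℝ) x * (p.coeff M : ℝ → ℝ) x) = 0 := by
    rw [← zsmul_eq_mul]; exact hx
  rcases mul_eq_zero.mp hx' with h' | h'
  · have : (∑ i ∈ Finset.range (N+2), ee i M - (1 - (n:ℤ)) : ℤ) = 0 := by exact_mod_cast h'
    omega
  · rcases mul_eq_zero.mp h' with h' | h'
    · exact absurd h' (hf x)
    · exact h'

theorem homogeneous_operator_rigidity
    (f : SF S) (hf : ∀ x, (dSF S hS f : ℝ → ℝ) x ≠ 0)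
    (m d : ℕ) (hd : 2 ≤ d) (P : ℕ → Rl S)
    (hPm : ∀ t, m < t → P t = 0)
    (hPc : ∀ t, InRt S (P t) ∧ IsHomog S ((d:ℤ) - t) (P t))
    (hLie : LieOp S hS (bfield S f) (fun n j => if n = 0 then P j else 0) = fun _ _ => 0) :
    ∀ t, P t = 0 := by
  have key : ∀ n, (∀ t, n < t → P t = 0) → P n = 0 := fun n hn =>
    top_zero f hf d n hd (P n) (hPc n).1.1 (hPc n).2 (key_eq f P n hn hLie)
  have step : ∀ k : ℕ, ∀ t, m < t + k → P t = 0 := by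
    intro k
    induction k with
    | zero => exact fun t ht => hPm t ht
    | succ k ih =>
      intro t ht
      exact key t (fun t' ht' => ih t' (by omega))
  intro t
  exact step (m+1) t (by omega)

end
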